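/- Suppose α, β > 0, α(‖P‖ + β‖H‖²) < 1, and ρ ∈ (0, 2), and let (z^j, w^j, ξ^j, η^j) be the xPIPG iterates from arbitrary initial points ξ¹ ∈ ℝ^n, η¹ ∈ ℝ^m. Then the limits z̄ := lim_{j→∞} (z^{j+1} − z^j) and w̄ := lim_{j→∞} (w^{j+1} − w^j) exist and satisfy ⟨q, z̄⟩ = −(1/(ρα))‖z̄‖² and σ_D(−Hᵀw̄) + ⟨g, w̄⟩ = −(1/(ρβ))‖w̄‖². -/

import Mathlib

open scoped RealInnerProductSpace
open Filter Topology Matrix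

/-- Spectral norm (largest singular value) of a real matrix. -/
noncomputable def specNorm {ι κ : Type*} [Fintype ι] [Fintype κ] [DecidableEq κ]
    (A : Matrix ι κ ℝ) : ℝ :=
  ‖LinearMap.toContinuousLinearMap (Matrix.toEuclideanLin A)‖

/-- The linear map on Euclidean space induced by a matrix (matrix-vector product). -/
noncomputable def mvec {ι κ : Type*} [Fintype ι] [Fintype κ] [DecidableEq κ]
    (A : Matrix ι κ ℝ) (x : EuclideanSpace ℝ κ) : EuclideanSpace ℝ ι :=
  Matrix.toEuclideanLin A x

open Classical in
/-- Projection onto a (nonempty closed convex) set: the minimizer of the distance to `x`. -/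
noncomputable def proj {ι : Type*} [Fintype ι] (C : Set (EuclideanSpace ℝ ι))
    (x : EuclideanSpace ℝ ι) : EuclideanSpace ℝ ι :=
  if h : ∃ y ∈ C, ∀ c ∈ C, ‖x - y‖ ≤ ‖x - c‖ then h.choose else x

/-- Polar cone `K° = {w | ⟨w, y⟩ ≤ 0 for all y ∈ K}`. -/
def polarCone {ι : Type*} [Fintype ι] (K : Set (EuclideanSpace ℝ ι)) :
    Set (EuclideanSpace ℝ ι) := {w | ∀ y ∈ K, ⟪w, y⟫ ≤ 0}

/-- Recession cone `rec D = {y | y + z ∈ D for all z ∈ D}`. -/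
def recCone {ι : Type*} [Fintype ι] (D : Set (EuclideanSpace ℝ ι)) :
    Set (EuclideanSpace ℝ ι) := {y | ∀ z ∈ D, y + z ∈ D}

/-- Normal cone of `C` at `x`: `N_C(x) = {y | ⟨y, x' − x⟩ ≤ 0 for all x' ∈ C}`. -/
def normalCone {ι : Type*} [Fintype ι] (C : Set (EuclideanSpace ℝ ι))
    (x : EuclideanSpace ℝ ι) : Set (EuclideanSpace ℝ ι) :=
  {y | ∀ x' ∈ C, ⟪y, x' - x⟫ ≤ 0}

/-- A closed convex cone. -/
def IsClosedConvexCone {ι : Type*} [Fintype ι] (K : Set (EuclideanSpace ℝ ι)) : Prop :=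
  IsClosed K ∧ Convex ℝ K ∧ ∀ w ∈ K, ∀ c : ℝ, 0 ≤ c → c • w ∈ K

/-- Support function of `D`, valued in `EReal`: `σ_D(x) = sup_{y ∈ D} ⟨y, x⟩`. -/
noncomputable def supportF {ι : Type*} [Fintype ι] (D : Set (EuclideanSpace ℝ ι))
    (x : EuclideanSpace ℝ ι) : EReal :=
  ⨆ y : D, ((⟪(y : EuclideanSpace ℝ ι), x⟫ : ℝ) : EReal)

/-- If a sequence in a finite-dimensional inner product space is the orbit of an averaged
operator, its successive differences converge. -/
theorem exists_tendsto_displacement {E : Type*} [NormedAddCommGroup E] [InnerProductSpace ℝ E]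
    [FiniteDimensional ℝ E] (x : ℕ → E) {κ : ℝ} (hκ : 0 < κ)
    (h : ∀ i j, ‖x (i + 1) - x (j + 1)‖ ^ 2
        + κ * ‖(x (i + 1) - x i) - (x (j + 1) - x j)‖ ^ 2 ≤ ‖x i - x j‖ ^ 2) :
    ∃ v, Tendsto (fun k => x (k + 1) - x k) atTop (𝓝 v) := by
  set e : ℕ → E := fun k => x (k + 1) - x k with he
  have hne : ∀ i j, ‖x (i + 1) - x (j + 1)‖ ≤ ‖x i - x j‖ := fun i j => by
    refine le_of_sq_le_sq ?_ (norm_nonneg _)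
    nlinarith [h i j, sq_nonneg ‖(x (i + 1) - x i) - (x (j + 1) - x j)‖]
  have hmono : ∀ i j, ⟪e i - e j, x i - x j⟫ ≤ 0 := fun i j => by
    have h1 := h i j
    have h2 : x (i + 1) - x (j + 1) = (x i - x j) + (e i - e j) := by simp only [he]; abel
    rw [h2, norm_add_sq_real, real_inner_comm] at h1
    change _ + κ * ‖e i - e j‖ ^ 2 ≤ _ at h1
    nlinarith [sq_nonneg ‖e i - e j‖]
  have hanti : Antitone fun k => ‖e k‖ := antitone_nat_of_succ_le fun k => hne (k + 1) k
  obtain ⟨r, hr⟩ : ∃ r, Tendsto (fun k => ‖e k‖) atTop (𝓝 r) :=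
    ⟨_, tendsto_atTop_ciInf hanti ⟨0, by rintro _ ⟨k, rfl⟩; exact norm_nonneg _⟩⟩
  have hr0 : 0 ≤ r := ge_of_tendsto' hr fun k => norm_nonneg _
  have hreg : Tendsto (fun k => e (k + 1) - e k) atTop (𝓝 0) := by
    rw [tendsto_zero_iff_norm_tendsto_zero]
    have h1 : Tendsto (fun k => κ⁻¹ * (‖e k‖ ^ 2 - ‖e (k + 1)‖ ^ 2)) atTop (𝓝 0) := by
      simpa using ((hr.pow 2).sub ((hr.comp (tendsto_add_atTop_nat 1)).pow 2)).const_mul κ⁻¹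
    have h2 : Tendsto (fun k => ‖e (k + 1) - e k‖ ^ 2) atTop (𝓝 0) := by
      refine squeeze_zero (fun _ => sq_nonneg _) (fun k => ?_) h1
      rw [le_inv_mul_iff₀ hκ]
      have := h (k + 1) k
      simp only [he] at this ⊢
      linarith
    simpa using h2.sqrt
  have hup : ∀ m k, ‖x (m + k) - x m‖ ≤ k * ‖e m‖ := fun m k => by
    induction k with
    | zero => simp
    | succ k ih =>
      have h1 : x (m + (k + 1)) - x m = e (m + k) + (x (m + k) - x m) := by
        simp only [he, ← add_assoc]; abel
      rw [h1]
      push_cast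
      have := hanti (Nat.le_add_right m k)
      have := norm_add_le (e (m + k)) (x (m + k) - x m)
      linarith
  have hlow : ∀ m k, k * r ≤ ‖x (m + k) - x m‖ := fun m k => by
    have hshift : Antitone fun n => ‖x (n + k) - x n‖ := antitone_nat_of_succ_le fun n => by
      have := hne (n + k) n
      rwa [add_right_comm] at this
    have h1 : Tendsto (fun n => x (n + k) - x n - (k : ℝ) • e n) atTop (𝓝 0) := by
      have hek : ∀ i, Tendsto (fun n => e (n + i) - e n) atTop (𝓝 0) := fun i => by
        induction i with
        | zero => simp
        | succ i ih =>
          have := (hreg.comp (tendsto_add_atTop_nat i)).add ih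
          simp only [add_zero] at this
          refine this.congr fun n => ?_
          simp only [Function.comp, ← add_assoc]; abel
      induction k with
      | zero => simp
      | succ k ih =>
        have ih' := ih (antitone_nat_of_succ_le fun n => by
          have := hne (n + k) n
          rwa [add_right_comm] at this)
        have := (hek k).add ih'
        simp only [add_zero] at this
        refine this.congr fun n => ?_
        simp only [he, ← add_assoc]
        push_cast
        module
    have h2 : Tendsto (fun n => (k : ℝ) * ‖e n‖ - ‖x (n + k) - x n - (k : ℝ) • e n‖) atTop
        (𝓝 (k * r)) := by simpa using (hr.const_mul (k : ℝ)).sub h1.norm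
    refine le_of_tendsto h2 ?_
    filter_upwards [eventually_ge_atTop m] with n hn
    have h3 := hshift hn
    have h4 := norm_sub_norm_le ((k : ℝ) • e n) ((k : ℝ) • e n - (x (n + k) - x n))
    rw [sub_sub_cancel, norm_sub_rev ((k : ℝ) • e n), norm_smul, Real.norm_natCast] at h4
    simp only at h3
    linarith
  -- Doubly averaged displacements from the base point `m`.
  set S : ℕ → ℕ → E := fun m k => (2 / (k : ℝ) ^ 2) • ∑ i ∈ Finset.range k, (x (m + i) - x m)
    with hS
  have hsum : ∀ k : ℕ, ∑ i ∈ Finset.range k, (i : ℝ) ≤ (k : ℝ) ^ 2 / 2 := fun k => by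
    induction k with
    | zero => simp
    | succ k ih => rw [Finset.sum_range_succ]; push_cast; nlinarith
  have hSup : ∀ m k, ‖S m k‖ ≤ ‖e m‖ := fun m k => by
    rcases Nat.eq_zero_or_pos k with rfl | hk
    · simp [hS]
    have hk' : (0 : ℝ) < k := by exact_mod_cast hk
    have h1 : ‖∑ i ∈ Finset.range k, (x (m + i) - x m)‖ ≤ (k : ℝ) ^ 2 / 2 * ‖e m‖ :=
      calc _ ≤ ∑ i ∈ Finset.range k, (i : ℝ) * ‖e m‖ :=
            norm_sum_le_of_le _ fun i _ => hup m i
        _ = (∑ i ∈ Finset.range k, (i : ℝ)) * ‖e m‖ := by rw [Finset.sum_mul]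
        _ ≤ _ := mul_le_mul_of_nonneg_right (hsum k) (norm_nonneg _)
    simp only [hS, norm_smul]
    rw [Real.norm_of_nonneg (by positivity)]
    calc _ ≤ 2 / (k : ℝ) ^ 2 * ((k : ℝ) ^ 2 / 2 * ‖e m‖) := by gcongr
      _ = ‖e m‖ := by field_simp
  have hSlow : ∀ m k, 0 < k → r ^ 2 - ‖e m‖ ^ 2 / k ≤ ⟪e m, S m k⟫ := fun m k hk => by
    have hk' : (0 : ℝ) < k := by exact_mod_cast hk
    have h1 : ‖x (m + k) - x m‖ ^ 2 - k * ‖e m‖ ^ 2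
        ≤ 2 * ∑ i ∈ Finset.range k, ⟪e m, x (m + i) - x m⟫ := by
      clear hk hk'
      induction k with
      | zero => simp
      | succ k ih =>
        rw [Finset.sum_range_succ]
        have h2 : x (m + (k + 1)) - x m = e (m + k) + (x (m + k) - x m) := by
          simp only [he, ← add_assoc]; abel
        rw [h2, norm_add_sq_real]
        have h3 := hmono (m + k) m
        rw [inner_sub_left] at h3
        have h4 : ‖e (m + k)‖ ^ 2 ≤ ‖e m‖ ^ 2 :=
          pow_le_pow_left₀ (norm_nonneg _) (hanti (Nat.le_add_right m k)) 2
        push_cast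
        linarith
    have h2 : (k * r) ^ 2 ≤ ‖x (m + k) - x m‖ ^ 2 :=
      pow_le_pow_left₀ (by positivity) (hlow m k) 2
    simp only [hS, inner_smul_right, inner_sum]
    have h3 : r ^ 2 - ‖e m‖ ^ 2 / k = 2 / (k : ℝ) ^ 2 * (((k * r) ^ 2 - k * ‖e m‖ ^ 2) / 2) := by
      field_simp
    rw [h3]
    gcongr
    linarith
  have hSbase : ∀ m, Tendsto (fun k => S m k - S 0 k) atTop (𝓝 0) := fun m => by
    have hb : ∀ k : ℕ, ‖S m k - S 0 k‖ ≤ (4 * m * ‖e 0‖) * (k : ℝ)⁻¹ := fun k => by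
      rcases Nat.eq_zero_or_pos k with rfl | hk
      · simp [hS]
      have hk' : (0 : ℝ) < k := by exact_mod_cast hk
      simp only [hS]
      rw [← smul_sub, ← Finset.sum_sub_distrib, norm_smul, Real.norm_of_nonneg (by positivity)]
      have h1 : ‖∑ i ∈ Finset.range k, ((x (m + i) - x m) - (x (0 + i) - x 0))‖
          ≤ ∑ i ∈ Finset.range k, (2 * m * ‖e 0‖) := by
        refine norm_sum_le_of_le _ fun i _ => ?_
        have h2 : (x (m + i) - x m) - (x (0 + i) - x 0)
            = (x (i + m) - x i) - (x (0 + m) - x 0) := by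
          rw [add_comm m i, zero_add, zero_add]; abel
        rw [h2]
        have h3 := hup i m
        have h4 := hup 0 m
        have h5 : (m : ℝ) * ‖e i‖ ≤ m * ‖e 0‖ := by gcongr; exact hanti (Nat.zero_le i)
        have h6 := norm_sub_le (x (i + m) - x i) (x (0 + m) - x 0)
        linarith
      rw [Finset.sum_const, Finset.card_range, nsmul_eq_mul] at h1
      calc _ ≤ 2 / (k : ℝ) ^ 2 * (k * (2 * m * ‖e 0‖)) := by gcongr
        _ = _ := by field_simp; ring
    refine squeeze_zero_norm hb ?_
    simpa using (tendsto_inv_atTop_nhds_zero_nat (𝕜 := ℝ)).const_mul (4 * m * ‖e 0‖)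
  obtain ⟨v, -, φ, hφ, hv⟩ := tendsto_subseq_of_bounded
    (Metric.isBounded_closedBall (x := (0 : E)) (r := ‖e 0‖)) (x := S 0)
    fun k => by simpa using hSup 0 k
  have hvm : ∀ m, Tendsto (fun k => S m (φ k)) atTop (𝓝 v) := fun m => by
    simpa using ((hSbase m).comp hφ.tendsto_atTop).add hv
  have hvr : ‖v‖ ≤ r := ge_of_tendsto' hr fun m => le_of_tendsto' (hvm m).norm fun k => hSup m _
  have hve : ∀ m, r ^ 2 ≤ ⟪e m, v⟫ := fun m => by
    have h1 : Tendsto (fun k : ℕ => r ^ 2 - ‖e m‖ ^ 2 / (φ k : ℝ)) atTop (𝓝 (r ^ 2)) := by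
      have := ((tendsto_inv_atTop_nhds_zero_nat (𝕜 := ℝ)).comp hφ.tendsto_atTop).const_mul
        (‖e m‖ ^ 2)
      simpa [div_eq_mul_inv] using this.const_sub (r ^ 2)
    refine le_of_tendsto_of_tendsto h1 (tendsto_const_nhds.inner (hvm m)) ?_
    filter_upwards [hφ.tendsto_atTop.eventually_gt_atTop 0] with k hk
    exact hSlow m _ hk
  refine ⟨v, ?_⟩
  rw [tendsto_iff_norm_sub_tendsto_zero]
  have h1 : Tendsto (fun m => ‖e m‖ ^ 2 - r ^ 2) atTop (𝓝 0) := by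
    have := (hr.pow 2).sub_const (r ^ 2)
    rwa [sub_self] at this
  have h2 : Tendsto (fun m => ‖e m - v‖ ^ 2) atTop (𝓝 0) := by
    refine squeeze_zero (fun _ => sq_nonneg _) (fun m => ?_) h1
    rw [norm_sub_sq_real]
    have := pow_le_pow_left₀ (norm_nonneg v) hvr 2
    linarith [hve m]
  simpa using h2.sqrt

/-- A positive operator on a finite-dimensional space is the Gram operator of a linear map. -/
theorem LinearMap.IsPositive.exists_inner_map_map_eq {V : Type*} [NormedAddCommGroup V]
    [InnerProductSpace ℝ V] [FiniteDimensional ℝ V] {T : V →ₗ[ℝ] V} (hT : T.IsPositive) :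
    ∃ (k : ℕ) (L : V →ₗ[ℝ] EuclideanSpace ℝ (Fin k)), ∀ x y, ⟪L x, L y⟫ = ⟪T x, y⟫ := by
  have hT' : (LinearMap.toContinuousLinearMap T).IsPositive := hT
  obtain ⟨k, u, hu⟩ := ContinuousLinearMap.isPositive_iff_eq_sum_rankOne.1 hT'
  refine ⟨k,
    { toFun := fun x => WithLp.toLp 2 fun i => ⟪u i, x⟫
      map_add' := fun x y => by ext i; simp [inner_add_right]
      map_smul' := fun c x => by ext i; simp [inner_smul_right] }, fun x y => ?_⟩
  have h1 : T x = ∑ i, ⟪u i, x⟫ • u i := by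
    have := congrArg (fun S : V →L[ℝ] V => S x) hu
    simpa using this
  rw [h1, sum_inner]
  simp [PiLp.inner_apply, inner_smul_left, mul_comm]

/-- Relaxed resolvent iterations in the metric of a positive definite operator have convergent
displacements. -/
theorem exists_tendsto_displacement_of_resolvent {V : Type*} [NormedAddCommGroup V]
    [InnerProductSpace ℝ V] [FiniteDimensional ℝ V] {T : V →ₗ[ℝ] V} (hT : T.IsSymmetric)
    (hpos : ∀ v, v ≠ 0 → 0 < ⟪T v, v⟫) {ρ : ℝ} (hρ : ρ ∈ Set.Ioo (0 : ℝ) 2) (p t : ℕ → V)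
    (hp : ∀ k, p (k + 1) = (1 - ρ) • p k + ρ • t k)
    (hmono : ∀ i j, 0 ≤ ⟪T ((p i - p j) - (t i - t j)), t i - t j⟫) :
    ∃ v, Tendsto (fun k => p (k + 1) - p k) atTop (𝓝 v) := by
  obtain ⟨hρ0, hρ2⟩ := hρ
  have hT' : T.IsPositive := by
    refine (LinearMap.isPositive_iff T).2 ⟨hT, fun v => ?_⟩
    rcases eq_or_ne v 0 with rfl | hv
    · simp
    · exact (hpos v hv).le
  obtain ⟨k, L, hL⟩ := hT'.exists_inner_map_map_eq
  have hker : L.ker = ⊥ := by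
    refine LinearMap.ker_eq_bot'.2 fun v hv => ?_
    by_contra hne
    have := hL v v
    rw [hv, inner_zero_left] at this
    linarith [hpos v hne]
  have hemb := LinearMap.isClosedEmbedding_of_injective hker
  obtain ⟨l, hl⟩ := exists_tendsto_displacement (fun k => L (p k))
    (κ := (2 - ρ) / ρ) (div_pos (by linarith) hρ0) fun i j => by
      set a := L (p i) - L (p j) with ha
      set b := L (t i) - L (t j) with hb
      have h1 := hmono i j
      rw [← hL] at h1
      simp only [map_sub] at h1
      rw [← ha, ← hb] at h1
      have h2 : L (p (i + 1)) - L (p (j + 1)) = a + ρ • (b - a) := by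
        simp only [hp, map_add, map_smul, ha, hb]; module
      have h3 : L (p (i + 1)) - L (p i) - (L (p (j + 1)) - L (p j)) = ρ • (b - a) := by
        simp only [hp, map_add, map_smul, ha, hb]; module
      rw [h2, h3, norm_add_sq_real, norm_smul, mul_pow, inner_smul_right, Real.norm_eq_abs, sq_abs]
      have h4 : ⟪a, b - a⟫ = - ‖b - a‖ ^ 2 - ⟪a - b, b⟫ := by
        rw [← real_inner_self_eq_norm_sq]
        simp only [inner_sub_left, inner_sub_right, real_inner_comm a b]
        ring
      rw [h4]
      have h5 : (2 - ρ) / ρ * (ρ ^ 2 * ‖b - a‖ ^ 2) = (2 - ρ) * ρ * ‖b - a‖ ^ 2 := by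
        field_simp
      rw [h5]
      nlinarith [mul_nonneg hρ0.le h1]
  have hl' : Tendsto (fun k => L (p (k + 1) - p k)) atTop (𝓝 l) := by simpa using hl
  obtain ⟨v, rfl⟩ : l ∈ Set.range L :=
    hemb.isClosed_range.mem_of_tendsto hl' (Eventually.of_forall fun k => ⟨_, rfl⟩)
  exact ⟨v, (hemb.tendsto_nhds_iff).2 hl'⟩

/-- The metric operator of the proportional-integral projected gradient iteration. -/
noncomputable def pipgMetric {E F : Type*} [NormedAddCommGroup E] [InnerProductSpace ℝ E]
    [FiniteDimensional ℝ E] [NormedAddCommGroup F] [InnerProductSpace ℝ F]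
    [FiniteDimensional ℝ F] (P : E →L[ℝ] E) (H : E →L[ℝ] F) (α β : ℝ) :
    WithLp 2 (E × F) →ₗ[ℝ] WithLp 2 (E × F) where
  toFun v := WithLp.toLp 2
    (α⁻¹ • v.fst - P v.fst - H.adjoint v.snd, β⁻¹ • v.snd - H v.fst)
  map_add' u v := by
    refine (WithLp.ofLp_injective 2) (Prod.ext ?_ ?_) <;> simp <;> abel
  map_smul' c v := by
    refine (WithLp.ofLp_injective 2) (Prod.ext ?_ ?_) <;> simp [smul_sub, smul_comm c]

section

variable {E F : Type*} [NormedAddCommGroup E] [InnerProductSpace ℝ E]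
    [FiniteDimensional ℝ E] [NormedAddCommGroup F] [InnerProductSpace ℝ F]
    [FiniteDimensional ℝ F] {P : E →L[ℝ] E} {H : E →L[ℝ] F} {α β : ℝ}

theorem inner_pipgMetric (u v : WithLp 2 (E × F)) :
    ⟪pipgMetric P H α β u, v⟫ = α⁻¹ * ⟪u.fst, v.fst⟫ - ⟪P u.fst, v.fst⟫ - ⟪u.snd, H v.fst⟫
      + (β⁻¹ * ⟪u.snd, v.snd⟫ - ⟪H u.fst, v.snd⟫) := by
  simp [pipgMetric, WithLp.prod_inner_apply, inner_sub_left, inner_smul_left,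
    ContinuousLinearMap.adjoint_inner_left]

theorem pipgMetric_isSymmetric (hP : P.IsPositive) : (pipgMetric P H α β).IsSymmetric := by
  intro u v
  rw [real_inner_comm (pipgMetric P H α β v) u, inner_pipgMetric, inner_pipgMetric,
    real_inner_comm v.fst u.fst, real_inner_comm v.snd u.snd, hP.inner_left_eq_inner_right,
    real_inner_comm (P v.fst) u.fst, real_inner_comm (H v.fst) u.snd,
    real_inner_comm (H u.fst) v.snd]
  ring

theorem inner_pipgMetric_self_pos (hα : 0 < α) (hβ : 0 < β)
    (hstep : α * (‖P‖ + β * ‖H‖ ^ 2) < 1) (v : WithLp 2 (E × F)) (hv : v ≠ 0) :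
    0 < ⟪pipgMetric P H α β v, v⟫ := by
  have h1 : ⟪P v.fst, v.fst⟫ ≤ ‖P‖ * ‖v.fst‖ ^ 2 :=
    (real_inner_le_norm _ _).trans (by
      have := P.le_opNorm v.fst
      nlinarith [norm_nonneg v.fst])
  have h2 : ⟪H v.fst, v.snd⟫ ≤ ‖H‖ * ‖v.fst‖ * ‖v.snd‖ :=
    (real_inner_le_norm _ _).trans (mul_le_mul_of_nonneg_right (H.le_opNorm _) (norm_nonneg _))
  rw [inner_pipgMetric, real_inner_comm (H v.fst) v.snd, real_inner_self_eq_norm_sq,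
    real_inner_self_eq_norm_sq]
  have h3 : 0 < α⁻¹ - ‖P‖ - β * ‖H‖ ^ 2 := by
    have : α * (α⁻¹ - ‖P‖ - β * ‖H‖ ^ 2) = 1 - α * (‖P‖ + β * ‖H‖ ^ 2) := by
      field_simp
      ring
    exact pos_of_mul_pos_right (by rw [this]; linarith) hα.le
  have h4 : α⁻¹ * ‖v.fst‖ ^ 2 - ‖P‖ * ‖v.fst‖ ^ 2 - 2 * (‖H‖ * ‖v.fst‖ * ‖v.snd‖)
      + β⁻¹ * ‖v.snd‖ ^ 2 = (α⁻¹ - ‖P‖ - β * ‖H‖ ^ 2) * ‖v.fst‖ ^ 2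
        + β⁻¹ * (‖v.snd‖ - β * ‖H‖ * ‖v.fst‖) ^ 2 := by
    field_simp
    ring
  have hβ' : 0 < β⁻¹ := inv_pos.2 hβ
  have h5 : 0 < (α⁻¹ - ‖P‖ - β * ‖H‖ ^ 2) * ‖v.fst‖ ^ 2
        + β⁻¹ * (‖v.snd‖ - β * ‖H‖ * ‖v.fst‖) ^ 2 := by
    rcases eq_or_ne v.fst 0 with h0 | h0
    · have h6 : v.snd ≠ 0 := fun h6 => hv (WithLp.ofLp_injective 2 (Prod.ext h0 h6))
      have := norm_pos_iff.2 h6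
      rw [h0]
      simp only [norm_zero]
      ring_nf
      positivity
    · have := norm_pos_iff.2 h0
      positivity
  linarith

/-- The displacements of the extrapolated PIPG iteration converge. -/
theorem exists_tendsto_pipg_displacement {ρ : ℝ} {q : E} {g : F} {D : Set E} {C : Set F}
    (hP : P.IsPositive) (hα : 0 < α) (hβ : 0 < β)
    (hstep : α * (‖P‖ + β * ‖H‖ ^ 2) < 1) (hρ : ρ ∈ Set.Ioo (0 : ℝ) 2)
    {z ξ : ℕ → E} {w η : ℕ → F}
    (hzD : ∀ k, z k ∈ D) (hwC : ∀ k, w k ∈ C)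
    (hz : ∀ k, ∀ x ∈ D, ⟪ξ k - α • (P (ξ k) + q + H.adjoint (η k)) - z k, x - z k⟫ ≤ 0)
    (hw : ∀ k, ∀ y ∈ C, ⟪η k + β • (H ((2 : ℝ) • z k - ξ k) - g) - w k, y - w k⟫ ≤ 0)
    (hξ : ∀ k, ξ (k + 1) = (1 - ρ) • ξ k + ρ • z k)
    (hη : ∀ k, η (k + 1) = (1 - ρ) • η k + ρ • w k) :
    ∃ (a : E) (b : F), Tendsto (fun k => ξ (k + 1) - ξ k) atTop (𝓝 a) ∧
      Tendsto (fun k => η (k + 1) - η k) atTop (𝓝 b) := by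
  obtain ⟨v, hv⟩ := exists_tendsto_displacement_of_resolvent (pipgMetric_isSymmetric hP)
    (inner_pipgMetric_self_pos hα hβ hstep) hρ
    (fun k => WithLp.toLp 2 (ξ k, η k)) (fun k => WithLp.toLp 2 (z k, w k))
    (fun k => by
      refine (WithLp.ofLp_injective 2) (Prod.ext ?_ ?_) <;> simp [hξ, hη])
    (fun i j => by
      have h1 := add_le_add (hz i _ (hzD j)) (hz j _ (hzD i))
      have h2 := add_le_add (hw i _ (hwC j)) (hw j _ (hwC i))
      have h3 := hP.inner_nonneg_left (z i - z j)
      rw [inner_pipgMetric]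
      have e1 : ⟪ξ i - α • (P (ξ i) + q + H.adjoint (η i)) - z i, z j - z i⟫
          + ⟪ξ j - α • (P (ξ j) + q + H.adjoint (η j)) - z j, z i - z j⟫
          = - (⟪(ξ i - ξ j) - (z i - z j), z i - z j⟫ - α * (⟪P (ξ i - ξ j), z i - z j⟫
            + ⟪η i - η j, H (z i - z j)⟫)) := by
        simp only [inner_sub_left, inner_add_left, inner_sub_right, inner_smul_left,
          ContinuousLinearMap.adjoint_inner_left, map_sub, RCLike.conj_to_real]
        ring
      have e2 : ⟪η i + β • (H ((2 : ℝ) • z i - ξ i) - g) - w i, w j - w i⟫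
          + ⟪η j + β • (H ((2 : ℝ) • z j - ξ j) - g) - w j, w i - w j⟫
          = - (⟪(η i - η j) - (w i - w j), w i - w j⟫ + β * (2 * ⟪H (z i - z j), w i - w j⟫
            - ⟪H (ξ i - ξ j), w i - w j⟫)) := by
        simp only [inner_sub_left, inner_add_left, inner_sub_right, inner_smul_left,
          map_sub, map_smul, RCLike.conj_to_real]
        ring
      rw [e1, add_zero, neg_nonpos] at h1
      rw [e2, add_zero, neg_nonpos] at h2
      have h1' := mul_nonneg (inv_pos.2 hα).le h1
      have h2' := mul_nonneg (inv_pos.2 hβ).le h2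
      rw [mul_sub, inv_mul_cancel_left₀ hα.ne'] at h1'
      rw [mul_add, inv_mul_cancel_left₀ hβ.ne'] at h2'
      simp only [WithLp.sub_fst, WithLp.sub_snd, WithLp.toLp_fst, WithLp.toLp_snd]
      rw [map_sub P (ξ i - ξ j), inner_sub_left (P (ξ i - ξ j)), map_sub H (ξ i - ξ j),
        inner_sub_left (H (ξ i - ξ j)), inner_sub_left (η i - η j) (w i - w j) (H (z i - z j)),
        real_inner_comm (H (z i - z j)) (w i - w j)]
      linarith)
  have hc := (WithLp.prod_continuous_ofLp 2 E F).tendsto v |>.comp hv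
  exact ⟨_, _, (continuous_fst.tendsto _).comp hc, (continuous_snd.tendsto _).comp hc⟩

/-- Limits of the displacements of the extrapolated PIPG iteration satisfy the two identities
relating them to the data of the problem. -/
theorem pipg_displacement_identities {ρ : ℝ} {q : E} {g : F} {D : Set E} {C : Set F}
    (hP : P.IsPositive) (hα : 0 < α) (hβ : 0 < β) (hρ : ρ ≠ 0)
    (hDcl : IsClosed D) (hDcv : Convex ℝ D) (hCcl : IsClosed C)
    (hCsmul : ∀ x ∈ C, ∀ c : ℝ, 0 ≤ c → c • x ∈ C)
    {z ξ : ℕ → E} {w η : ℕ → F}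
    (hzD : ∀ k, z k ∈ D) (hwC : ∀ k, w k ∈ C)
    (hz : ∀ k, ∀ x ∈ D, ⟪ξ k - α • (P (ξ k) + q + H.adjoint (η k)) - z k, x - z k⟫ ≤ 0)
    (hw : ∀ k, ∀ y ∈ C, ⟪η k + β • (H ((2 : ℝ) • z k - ξ k) - g) - w k, y - w k⟫ ≤ 0)
    (hξ : ∀ k, ξ (k + 1) = (1 - ρ) • ξ k + ρ • z k)
    (hη : ∀ k, η (k + 1) = (1 - ρ) • η k + ρ • w k) {v : E} {u : F}
    (hv : Tendsto (fun k => ξ (k + 1) - ξ k) atTop (𝓝 v))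
    (hu : Tendsto (fun k => η (k + 1) - η k) atTop (𝓝 u)) :
    ⟪q, v⟫ = -(1 / (ρ * α)) * ‖v‖ ^ 2 ∧
      IsLUB ((fun x => ⟪x, -(H.adjoint u)⟫) '' D) (-(1 / (ρ * β)) * ‖u‖ ^ 2 - ⟪g, u⟫) := by
  have hα' := inv_pos.2 hα
  have hβ' := inv_pos.2 hβ
  set c : ℕ → ℝ := fun k => (k : ℝ)⁻¹
  have hc0 : ∀ k, 0 ≤ c k := fun k => by positivity
  have hclim : Tendsto c atTop (𝓝 0) := tendsto_inv_atTop_nhds_zero_nat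
  -- Increments of both sequences, and their averaged growth.
  set δ : ℕ → E := fun k => z k - ξ k with hδdef
  set ε : ℕ → F := fun k => w k - η k with hεdef
  have hδ : Tendsto δ atTop (𝓝 (ρ⁻¹ • v)) := (hv.const_smul ρ⁻¹).congr fun k => by
    rw [hξ, show (1 - ρ) • ξ k + ρ • z k - ξ k = ρ • (z k - ξ k) by module, inv_smul_smul₀ hρ]
  have hε : Tendsto ε atTop (𝓝 (ρ⁻¹ • u)) := (hu.const_smul ρ⁻¹).congr fun k => by
    rw [hη, show (1 - ρ) • η k + ρ • w k - η k = ρ • (w k - η k) by module, inv_smul_smul₀ hρ]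
  have hX : Tendsto (fun k => c k • ξ k) atTop (𝓝 v) := by
    have := hv.cesaro_smul.add (hclim.smul_const (ξ 0))
    simp only [zero_smul, add_zero] at this
    refine this.congr fun k => ?_
    rw [Finset.sum_range_sub, ← smul_add, sub_add_cancel]
  have hN : Tendsto (fun k => c k • η k) atTop (𝓝 u) := by
    have := hu.cesaro_smul.add (hclim.smul_const (η 0))
    simp only [zero_smul, add_zero] at this
    refine this.congr fun k => ?_
    rw [Finset.sum_range_sub, ← smul_add, sub_add_cancel]
  have hZ : Tendsto (fun k => c k • z k) atTop (𝓝 v) := by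
    have := hX.add (hclim.smul hδ)
    simp only [zero_smul, add_zero] at this
    refine this.congr fun k => ?_
    rw [← smul_add, hδdef, add_sub_cancel]
  have hW : Tendsto (fun k => c k • w k) atTop (𝓝 u) := by
    have := hN.add (hclim.smul hε)
    simp only [zero_smul, add_zero] at this
    refine this.congr fun k => ?_
    rw [← smul_add, hεdef, add_sub_cancel]
  -- Normal vectors at the iterates.
  set r : ℕ → E := fun k => -(α⁻¹ • δ k) - P (ξ k) - q - H.adjoint (η k) with hr
  set s : ℕ → F := fun k => -(β⁻¹ • ε k) + H (z k + δ k) - g with hs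
  have hrD : ∀ k, ∀ x ∈ D, ⟪r k, x - z k⟫ ≤ 0 := fun k x hx => by
    have h1 : r k = α⁻¹ • (ξ k - α • (P (ξ k) + q + H.adjoint (η k)) - z k) := by
      rw [sub_right_comm, smul_sub, inv_smul_smul₀ hα.ne']
      simp only [hr, hδdef]
      module
    rw [h1, real_inner_smul_left]
    exact mul_nonpos_of_nonneg_of_nonpos hα'.le (hz k x hx)
  have hsC' : ∀ k, ∀ y ∈ C, ⟪s k, y - w k⟫ ≤ 0 := fun k y hy => by
    have h1 : s k = β⁻¹ • (η k + β • (H ((2 : ℝ) • z k - ξ k) - g) - w k) := by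
      rw [add_sub_right_comm, smul_add, inv_smul_smul₀ hβ.ne']
      have h2 : z k + δ k = (2 : ℝ) • z k - ξ k := by simp only [hδdef]; module
      simp only [hs, hεdef, h2]
      module
    rw [h1, real_inner_smul_left]
    exact mul_nonpos_of_nonneg_of_nonpos hβ'.le (hw k y hy)
  have hsw : ∀ k, ⟪s k, w k⟫ = 0 := fun k => by
    have h1 := hsC' k _ (hCsmul _ (hwC k) 0 le_rfl)
    have h2 := hsC' k _ (hCsmul _ (hwC k) 2 zero_le_two)
    simp only [inner_sub_right, real_inner_smul_right] at h1 h2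
    linarith
  have hsC : ∀ k, ∀ y ∈ C, ⟪s k, y⟫ ≤ 0 := fun k y hy => by
    have h1 := hsC' k y hy
    rw [inner_sub_right, hsw] at h1
    linarith
  have hcr : Tendsto (fun k => c k • r k) atTop (𝓝 (-(P v) - H.adjoint u)) := by
    have h1 := ((((hclim.smul (hδ.const_smul α⁻¹)).neg.sub ((P.continuous.tendsto _).comp hX)).sub
      (hclim.smul_const q)).sub ((H.adjoint.continuous.tendsto _).comp hN))
    simp only [zero_smul, neg_zero, zero_sub, sub_zero] at h1
    refine h1.congr fun k => ?_
    simp only [Function.comp, map_smul, hr]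
    module
  have hcs : Tendsto (fun k => c k • s k) atTop (𝓝 (H v)) := by
    have h1 := (((hclim.smul (hε.const_smul β⁻¹)).neg.add ((H.continuous.tendsto _).comp
      (hZ.add (hclim.smul hδ)))).sub (hclim.smul_const g))
    simp only [zero_smul, neg_zero, zero_add, sub_zero, add_zero] at h1
    refine h1.congr fun k => ?_
    simp only [Function.comp, ← smul_add, map_smul, hs]
    module
  have hHvu : ⟪H v, u⟫ = 0 := by
    refine tendsto_nhds_unique (hcs.inner hW) (tendsto_const_nhds.congr fun k => ?_)
    rw [real_inner_smul_left, real_inner_smul_right, hsw, mul_zero, mul_zero]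
  have hHvC : ∀ y ∈ C, ⟪H v, y⟫ ≤ 0 := fun y hy => by
    refine le_of_tendsto' (hcs.inner tendsto_const_nhds) fun k => ?_
    rw [real_inner_smul_left]
    exact mul_nonpos_of_nonneg_of_nonpos (hc0 k) (hsC k y hy)
  have hPv : ∀ x, ⟪P x, v⟫ = 0 := by
    have h1 : ⟪-(P v) - H.adjoint u, (0 : ℝ) • z 0 - v⟫ ≤ 0 := by
      refine le_of_tendsto' (hcr.inner ((hclim.smul_const (z 0)).sub hZ)) fun k => ?_
      rw [← smul_sub, real_inner_smul_left, real_inner_smul_right]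
      exact mul_nonpos_of_nonneg_of_nonpos (hc0 k)
        (mul_nonpos_of_nonneg_of_nonpos (hc0 k) (hrD k _ (hzD 0)))
    rw [zero_smul, zero_sub, inner_neg_right, inner_sub_left, inner_neg_left,
      ContinuousLinearMap.adjoint_inner_left, real_inner_comm (H v) u, hHvu] at h1
    obtain ⟨n, L, hL⟩ := hP.toLinearMap.exists_inner_map_map_eq
    have h2 : L v = 0 := by
      rw [← inner_self_eq_zero (𝕜 := ℝ)]
      refine le_antisymm ?_ real_inner_self_nonneg
      rw [hL]
      change ⟪P v, v⟫ ≤ 0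
      linarith
    intro x
    have h3 := hL x v
    rw [h2, inner_zero_right] at h3
    exact h3.symm
  have hDv : ∀ x ∈ D, x + v ∈ D := fun x hx => by
    have h1 : Tendsto (fun k => (1 - c k) • x + c k • z k) atTop (𝓝 (x + v)) := by
      simpa using ((hclim.const_sub 1).smul_const x).add hZ
    refine hDcl.mem_of_tendsto h1 ?_
    filter_upwards [eventually_ge_atTop 1] with k hk
    have h2 : c k ≤ 1 := inv_le_one_of_one_le₀ (by exact_mod_cast hk)
    exact hDcv hx (hzD k) (sub_nonneg.2 h2) (hc0 k) (by ring)
  have huC : u ∈ C :=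
    hCcl.mem_of_tendsto hW (Eventually.of_forall fun k => hCsmul _ (hwC k) _ (hc0 k))
  have hHδ : ∀ y : F, Tendsto (fun k => ⟪H (δ k), y⟫) atTop (𝓝 ⟪H (ρ⁻¹ • v), y⟫) := fun y =>
    ((H.continuous.tendsto _).comp hδ).inner tendsto_const_nhds
  have hnv : ⟪ρ⁻¹ • v, v⟫ = ρ⁻¹ * ‖v‖ ^ 2 := by
    rw [real_inner_smul_left, real_inner_self_eq_norm_sq]
  have hnu : ⟪ρ⁻¹ • u, u⟫ = ρ⁻¹ * ‖u‖ ^ 2 := by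
    rw [real_inner_smul_left, real_inner_self_eq_norm_sq]
  have hHvu' : ⟪H (ρ⁻¹ • v), u⟫ = 0 := by rw [map_smul, real_inner_smul_left, hHvu, mul_zero]
  have huHv' : ⟪ρ⁻¹ • u, H v⟫ = 0 := by
    rw [real_inner_smul_left, real_inner_comm, hHvu, mul_zero]
  have hqv : -(α⁻¹ * (ρ⁻¹ * ‖v‖ ^ 2)) - ⟪q, v⟫ ≤ 0 := by
    have h1 : Tendsto (fun k => -(α⁻¹ * ⟪δ k, v⟫) - ⟪q, v⟫ + ⟪ε k, H v⟫) atTop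
        (𝓝 (-(α⁻¹ * ⟪ρ⁻¹ • v, v⟫) - ⟪q, v⟫ + ⟪ρ⁻¹ • u, H v⟫)) :=
      (((hδ.inner tendsto_const_nhds).const_mul _).neg.sub_const _).add
        (hε.inner tendsto_const_nhds)
    rw [hnv, huHv', add_zero] at h1
    refine le_of_tendsto' h1 fun k => ?_
    have h2 := hrD k _ (hDv _ (hzD k))
    have h3 := hHvC _ (hwC k)
    have h4 : ⟪ε k, H v⟫ = ⟪H v, w k⟫ - ⟪η k, H v⟫ := by
      rw [real_inner_comm (w k), ← inner_sub_left]
    rw [add_sub_cancel_left] at h2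
    simp only [hr, inner_sub_left, inner_neg_left, real_inner_smul_left,
      ContinuousLinearMap.adjoint_inner_left, hPv] at h2
    linarith
  have hlow : ∀ M, (∀ x ∈ D, ⟪x, -(H.adjoint u)⟫ ≤ M) →
      -(β⁻¹ * (ρ⁻¹ * ‖u‖ ^ 2)) - ⟪g, u⟫ ≤ M := fun M hM => by
    have h1 : Tendsto (fun k => -(β⁻¹ * ⟪ε k, u⟫) - ⟪g, u⟫ + ⟪H (δ k), u⟫) atTop
        (𝓝 (-(β⁻¹ * ⟪ρ⁻¹ • u, u⟫) - ⟪g, u⟫ + ⟪H (ρ⁻¹ • v), u⟫)) :=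
      (((hε.inner tendsto_const_nhds).const_mul _).neg.sub_const _).add (hHδ u)
    rw [hnu, hHvu', add_zero] at h1
    refine le_of_tendsto' h1 fun k => ?_
    have h2 := hsC k u huC
    have h3 := hM _ (hzD k)
    rw [inner_neg_right, ContinuousLinearMap.adjoint_inner_right] at h3
    simp only [hs, inner_sub_left, inner_add_left, inner_neg_left, real_inner_smul_left,
      map_add] at h2
    linarith
  have hupper : ∀ x ∈ D, ⟪x, -(H.adjoint u)⟫ ≤ -(α⁻¹ * (ρ⁻¹ * ‖v‖ ^ 2)) - ⟪q, v⟫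
      - (β⁻¹ * (ρ⁻¹ * ‖u‖ ^ 2)) - ⟪g, u⟫ := fun x hx => by
    have h1 : Tendsto (fun k => -(α⁻¹ * ⟪δ k, c k • z k⟫) + ⟪P (δ k), c k • z k⟫
        - ⟪q, c k • z k⟫ - (β⁻¹ * ⟪ε k, c k • w k⟫ - ⟪H (δ k), c k • w k⟫ + ⟪g, c k • w k⟫
          - ⟪ε k, H (c k • z k)⟫)) atTop
        (𝓝 (-(α⁻¹ * ⟪ρ⁻¹ • v, v⟫) + ⟪P (ρ⁻¹ • v), v⟫ - ⟪q, v⟫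
          - (β⁻¹ * ⟪ρ⁻¹ • u, u⟫ - ⟪H (ρ⁻¹ • v), u⟫ + ⟪g, u⟫ - ⟪ρ⁻¹ • u, H v⟫))) :=
      ((((hδ.inner hZ).const_mul _).neg.add (((P.continuous.tendsto _).comp hδ).inner hZ)).sub
        (tendsto_const_nhds.inner hZ)).sub
        (((((hε.inner hW).const_mul _).sub (((H.continuous.tendsto _).comp hδ).inner hW)).add
        (tendsto_const_nhds.inner hW)).sub (hε.inner ((H.continuous.tendsto _).comp hZ)))
    rw [hnv, hnu, hPv, hHvu', huHv'] at h1
    have h2 : ⟪-(P v) - H.adjoint u, x⟫ = ⟪x, -(H.adjoint u)⟫ := by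
      have h3 : ⟪P v, x⟫ = 0 := by
        rw [hP.inner_left_eq_inner_right, real_inner_comm, hPv]
      rw [inner_sub_left, inner_neg_left, h3, inner_neg_right, real_inner_comm x]
      ring
    rw [← h2]
    refine (le_of_tendsto_of_tendsto' (hcr.inner tendsto_const_nhds) h1 fun k => ?_).trans
      (le_of_eq (by ring))
    have h3 := hrD k x hx
    have h4 := hsw k
    have h5 := hP.inner_nonneg_left (z k)
    have h6 : ⟪P (ξ k), z k⟫ = ⟪P (z k), z k⟫ - ⟪P (δ k), z k⟫ := by
      rw [← inner_sub_left, ← map_sub, hδdef, sub_sub_cancel]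
    have h7 : ⟪η k, H (z k)⟫ = ⟪H (z k), w k⟫ - ⟪ε k, H (z k)⟫ := by
      rw [real_inner_comm (w k), ← inner_sub_left, hεdef, sub_sub_cancel]
    rw [inner_sub_right] at h3
    have h8 : ⟪r k, z k⟫ = -(α⁻¹ * ⟪δ k, z k⟫) - ⟪P (ξ k), z k⟫ - ⟪q, z k⟫
        - ⟪η k, H (z k)⟫ := by
      simp only [hr, inner_sub_left, inner_neg_left, real_inner_smul_left,
        ContinuousLinearMap.adjoint_inner_left]
    simp only [hs, inner_sub_left, inner_add_left, inner_neg_left, real_inner_smul_left,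
      map_add] at h4
    simp only [map_smul, real_inner_smul_left, real_inner_smul_right]
    have h9 : ⟪r k, x⟫ ≤ -(α⁻¹ * ⟪δ k, z k⟫) + ⟪P (δ k), z k⟫ - ⟪q, z k⟫
        - (β⁻¹ * ⟪ε k, w k⟫ - ⟪H (δ k), w k⟫ + ⟪g, w k⟫ - ⟪ε k, H (z k)⟫) := by
      linarith
    exact (mul_le_mul_of_nonneg_left h9 (hc0 k)).trans (le_of_eq (by ring))
  have hle := hlow _ hupper
  have hcα : -(1 / (ρ * α)) * ‖v‖ ^ 2 = -(α⁻¹ * (ρ⁻¹ * ‖v‖ ^ 2)) := by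
    field_simp
  have hcβ : -(1 / (ρ * β)) * ‖u‖ ^ 2 = -(β⁻¹ * (ρ⁻¹ * ‖u‖ ^ 2)) := by
    field_simp
  rw [hcα, hcβ]
  refine ⟨by linarith, ?_, fun M hM => hlow M fun x hx => hM ⟨x, hx, rfl⟩⟩
  rintro _ ⟨x, hx, rfl⟩
  have := hupper x hx
  simp only
  linarith

end

/-- The displacements of a relaxed sequence and of the unrelaxed one have the same limit. -/
theorem tendsto_sub_of_relaxation {E : Type*} [NormedAddCommGroup E] [NormedSpace ℝ E] {ρ : ℝ}
    (hρ : ρ ≠ 0) {x t : ℕ → E} (hx : ∀ k, x (k + 1) = (1 - ρ) • x k + ρ • t k) {v : E}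
    (hv : Tendsto (fun k => x (k + 1) - x k) atTop (𝓝 v)) :
    Tendsto (fun k => t (k + 1) - t k) atTop (𝓝 v) := by
  have hv' := hv.comp (tendsto_add_atTop_nat 1)
  have h := hv.add ((hv'.sub hv).const_smul ρ⁻¹)
  rw [sub_self, smul_zero, add_zero] at h
  refine h.congr fun k => ?_
  have ht : ∀ k, t k = x k + ρ⁻¹ • (x (k + 1) - x k) := fun k => by
    rw [hx k, show (1 - ρ) • x k + ρ • t k - x k = ρ • (t k - x k) by module,
      inv_smul_smul₀ hρ, add_sub_cancel]
  rw [ht k, ht (k + 1)]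
  simp only [Function.comp]
  module

/-- The variational characterization of the projection onto a nonempty closed convex set. -/
theorem proj_mem_and_inner_le_zero {ι : Type*} [Fintype ι] {C : Set (EuclideanSpace ℝ ι)}
    (hne : C.Nonempty) (hcl : IsClosed C) (hcv : Convex ℝ C) (x : EuclideanSpace ℝ ι) :
    proj C x ∈ C ∧ ∀ y ∈ C, ⟪x - proj C x, y - proj C x⟫ ≤ 0 := by
  have hbdd : BddBelow (Set.range fun y : C => ‖x - y‖) :=
    ⟨0, by rintro _ ⟨y, rfl⟩; exact norm_nonneg _⟩
  have h : ∃ y ∈ C, ∀ c ∈ C, ‖x - y‖ ≤ ‖x - c‖ := by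
    obtain ⟨y, hy, h⟩ := exists_norm_eq_iInf_of_complete_convex hne hcl.isComplete hcv x
    exact ⟨y, hy, fun c hc => h ▸ ciInf_le hbdd ⟨c, hc⟩⟩
  rw [proj, dif_pos h]
  obtain ⟨hmem, hmin⟩ := h.choose_spec
  have : Nonempty C := hne.to_subtype
  refine ⟨hmem, (norm_eq_iInf_iff_real_inner_le_zero hcv hmem).1 (le_antisymm ?_ ?_)⟩
  · exact le_ciInf fun c => hmin c c.2
  · exact ciInf_le hbdd ⟨_, hmem⟩

theorem isClosed_polarCone {ι : Type*} [Fintype ι] (K : Set (EuclideanSpace ℝ ι)) :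
    IsClosed (polarCone K) := by
  simp only [polarCone, Set.ofPred_forall]
  exact isClosed_biInter fun y _ =>
    isClosed_le (continuous_id.inner continuous_const) continuous_const

theorem smul_mem_polarCone {ι : Type*} [Fintype ι] {K : Set (EuclideanSpace ℝ ι)}
    {w : EuclideanSpace ℝ ι} (hw : w ∈ polarCone K) {c : ℝ} (hc : 0 ≤ c) :
    c • w ∈ polarCone K := fun y hy => by
  rw [real_inner_smul_left]
  exact mul_nonpos_of_nonneg_of_nonpos hc (hw y hy)

theorem convex_polarCone {ι : Type*} [Fintype ι] (K : Set (EuclideanSpace ℝ ι)) :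
    Convex ℝ (polarCone K) := fun u hu w hw a b ha hb _ y hy => by
  rw [inner_add_left]
  exact add_nonpos (smul_mem_polarCone hu ha y hy) (smul_mem_polarCone hw hb y hy)

theorem supportF_eq_of_isLUB {ι : Type*} [Fintype ι] {D : Set (EuclideanSpace ℝ ι)}
    {x : EuclideanSpace ℝ ι} {s : ℝ} (h : IsLUB ((fun y => ⟪y, x⟫) '' D) s) :
    supportF D x = s := by
  refine le_antisymm (iSup_le fun y => EReal.coe_le_coe_iff.2 (h.1 ⟨y, y.2, rfl⟩)) ?_
  refine EReal.le_of_forall_lt_iff_le.1 fun M hM => EReal.coe_le_coe_iff.2 (h.2 ?_)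
  rintro _ ⟨y, hy, rfl⟩
  exact EReal.coe_le_coe_iff.1 ((le_iSup (fun y : D =>
    ((⟪(y : EuclideanSpace ℝ ι), x⟫ : ℝ) : EReal)) ⟨y, hy⟩).trans hM.le)

theorem mvec_transpose_eq_adjoint {ι κ : Type*} [Fintype ι] [Fintype κ] [DecidableEq ι]
    [DecidableEq κ] (H : Matrix ι κ ℝ) (y : EuclideanSpace ℝ ι) :
    mvec Hᵀ y = (LinearMap.toContinuousLinearMap (Matrix.toEuclideanLin H)).adjoint y := by
  refine ext_inner_left ℝ fun x => ?_
  rw [ContinuousLinearMap.adjoint_inner_right, mvec, ← conjTranspose_eq_transpose_of_trivial,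
    Matrix.toEuclideanLin_conjTranspose_eq_adjoint, LinearMap.adjoint_inner_right]
  rfl

/-- the two equalities `⟨q, z̄⟩ = −(1/(ρα))‖z̄‖²` and
`σ_D(−Hᵀw̄) + ⟨g, w̄⟩ = −(1/(ρβ))‖w̄‖²` for the xPIPG limits. -/
theorem stmt13 {n m : ℕ} (P : Matrix (Fin n) (Fin n) ℝ) (q : EuclideanSpace ℝ (Fin n))
    (H : Matrix (Fin m) (Fin n) ℝ) (g : EuclideanSpace ℝ (Fin m))
    (D : Set (EuclideanSpace ℝ (Fin n))) (K : Set (EuclideanSpace ℝ (Fin m)))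
    (hP : P.PosSemidef)
    (hDne : D.Nonempty) (hDcl : IsClosed D) (hDcv : Convex ℝ D)
    (hKne : K.Nonempty) (hK : IsClosedConvexCone K)
    (α β ρ : ℝ) (hα : 0 < α) (hβ : 0 < β)
    (hstep : α * (specNorm P + β * specNorm H ^ 2) < 1)
    (hρ : ρ ∈ Set.Ioo (0 : ℝ) 2)
    (z ξ : ℕ → EuclideanSpace ℝ (Fin n)) (w η : ℕ → EuclideanSpace ℝ (Fin m))
    (hz : ∀ j, 1 ≤ j → z (j + 1) = proj D (ξ j - α • (mvec P (ξ j) + q + mvec Hᵀ (η j))))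
    (hw : ∀ j, 1 ≤ j → w (j + 1) =
      proj (polarCone K) (η j + β • (mvec H ((2 : ℝ) • z (j + 1) - ξ j) - g)))
    (hξ : ∀ j, 1 ≤ j → ξ (j + 1) = (1 - ρ) • ξ j + ρ • z (j + 1))
    (hη : ∀ j, 1 ≤ j → η (j + 1) = (1 - ρ) • η j + ρ • w (j + 1)) :
    ∃ (zbar : EuclideanSpace ℝ (Fin n)) (wbar : EuclideanSpace ℝ (Fin m)),
      Tendsto (fun j : ℕ => z (j + 1) - z j) atTop (𝓝 zbar) ∧
      Tendsto (fun j : ℕ => w (j + 1) - w j) atTop (𝓝 wbar) ∧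
      ⟪q, zbar⟫ = -(1 / (ρ * α)) * ‖zbar‖ ^ 2 ∧
      supportF D (-(mvec Hᵀ wbar)) + ((⟪g, wbar⟫ : ℝ) : EReal) =
        ((-(1 / (ρ * β)) * ‖wbar‖ ^ 2 : ℝ) : EReal) := by
  set P' := LinearMap.toContinuousLinearMap (Matrix.toEuclideanLin P)
  set H' := LinearMap.toContinuousLinearMap (Matrix.toEuclideanLin H)
  have hPpos : P'.IsPositive := Matrix.isPositive_toEuclideanLin_iff.2 hP
  have hprojD := proj_mem_and_inner_le_zero hDne hDcl hDcv
  have hprojK := proj_mem_and_inner_le_zero (C := polarCone K)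
    ⟨0, fun y _ => by simp⟩ (isClosed_polarCone K) (convex_polarCone K)
  have hzD : ∀ k, z (k + 2) ∈ D := fun k => by
    rw [hz (k + 1) (by omega)]
    exact (hprojD _).1
  have hwK : ∀ k, w (k + 2) ∈ polarCone K := fun k => by
    rw [hw (k + 1) (by omega)]
    exact (hprojK _).1
  have hzvar : ∀ k, ∀ x ∈ D, ⟪ξ (k + 1) - α • (P' (ξ (k + 1)) + q + H'.adjoint (η (k + 1)))
      - z (k + 2), x - z (k + 2)⟫ ≤ 0 := fun k x hx => by
    have h1 := hz (k + 1) (by omega)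
    rw [mvec_transpose_eq_adjoint] at h1
    rw [h1]
    exact (hprojD _).2 x hx
  have hwvar : ∀ k, ∀ y ∈ polarCone K, ⟪η (k + 1)
      + β • (H' ((2 : ℝ) • z (k + 2) - ξ (k + 1)) - g) - w (k + 2), y - w (k + 2)⟫ ≤ 0 :=
    fun k y hy => by
      rw [hw (k + 1) (by omega)]
      exact (hprojK _).2 y hy
  have hξ' : ∀ k, ξ (k + 1 + 1) = (1 - ρ) • ξ (k + 1) + ρ • z (k + 2) :=
    fun k => hξ (k + 1) (by omega)
  have hη' : ∀ k, η (k + 1 + 1) = (1 - ρ) • η (k + 1) + ρ • w (k + 2) :=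
    fun k => hη (k + 1) (by omega)
  obtain ⟨v, u, hv, hu⟩ := exists_tendsto_pipg_displacement (z := fun k => z (k + 2))
    (ξ := fun k => ξ (k + 1)) (w := fun k => w (k + 2)) (η := fun k => η (k + 1)) hPpos hα hβ hstep hρ hzD hwK hzvar hwvar hξ' hη'
  obtain ⟨hq, hlub⟩ := pipg_displacement_identities (z := fun k => z (k + 2))
    (ξ := fun k => ξ (k + 1)) (w := fun k => w (k + 2)) (η := fun k => η (k + 1)) hPpos hα hβ hρ.1.ne' hDcl hDcv (isClosed_polarCone K)
    (fun x hx c hc => smul_mem_polarCone hx hc) hzD hwK hzvar hwvar hξ' hη' hv hu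
  refine ⟨v, u, ?_, ?_, hq, ?_⟩
  · exact (tendsto_add_atTop_iff_nat 2).1 (tendsto_sub_of_relaxation
      (x := fun k => ξ (k + 1)) (t := fun k => z (k + 2)) hρ.1.ne' hξ' hv)
  · exact (tendsto_add_atTop_iff_nat 2).1 (tendsto_sub_of_relaxation
      (x := fun k => η (k + 1)) (t := fun k => w (k + 2)) hρ.1.ne' hη' hu)
  · rw [mvec_transpose_eq_adjoint, supportF_eq_of_isLUB hlub, ← EReal.coe_add, sub_add_cancel]
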